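/- Let X be a set, Y ⊆ X, n ≥ 0, and x(1),…,x(n) ∈ X∖Y pairwise distinct; put W = {x(1),…,x(n)}, W(i) = W∖{x(i)}, G = R⁺_{W∪Y}, and I = Σ_{i=1}^{n} R⁺_{W(i)∪Y}. Then the quotient group G/I is torsion-free; that is, for every nonzero integer m and every a ∈ G, if m·a ∈ I then a ∈ I. -/

import Mathlib

set_option synthInstance.maxHeartbeats 1000000
set_option maxHeartbeats 1000000

/-- A multivariate integer polynomial is primitive if it is not divisible by any
integer `m > 1`. -/
def MvPrimitive {X : Type*} (q : MvPolynomial X ℤ) : Prop :=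
  ∀ m : ℤ, 1 < m → ¬ (MvPolynomial.C m ∣ q)

/-- `ℚ(X)`, the field of fractions of `ℤ[X]`. -/
abbrev FracField (X : Type*) := FractionRing (MvPolynomial X ℤ)

/-- The set of elements `p / q` of `ℚ(X)` with `p, q ∈ ℤ[X]` polynomials in the
variables from `Z` and `q` primitive. -/
def Rset (X : Type*) (Z : Set X) : Set (FracField X) :=
  {x | ∃ p q : MvPolynomial X ℤ,
      p ∈ MvPolynomial.supported ℤ Z ∧ q ∈ MvPolynomial.supported ℤ Z ∧
      MvPrimitive q ∧
      x = algebraMap (MvPolynomial X ℤ) (FracField X) p /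
          algebraMap (MvPolynomial X ℤ) (FracField X) q}

/-- `R_Z` as a subring of `ℚ(X)`; since the set `Rset X Z` is closed under the ring
operations (by Gauss's lemma), this subring is exactly `Rset X Z`. -/
noncomputable def Rsub (X : Type*) (Z : Set X) : Subring (FracField X) :=
  Subring.closure (Rset X Z)

/-- `R⁺_Z`, the additive group of `R_Z`, as an additive subgroup of `ℚ(X)`;
since the set `Rset X Z` is closed under addition and negation (by Gauss's lemma),
this additive subgroup is exactly `Rset X Z`. -/
noncomputable def Radd (X : Type*) (Z : Set X) : AddSubgroup (FracField X) :=
  AddSubgroup.closure (Rset X Z)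

open MvPolynomial in
/-- Reduction modulo `p` from `ℤ[X]` to the field `𝔽_p(X)`. -/
noncomputable def redHom (X : Type*) (p : ℕ) [Fact p.Prime] :
    MvPolynomial X ℤ →+* FractionRing (MvPolynomial X (ZMod p)) :=
  (algebraMap (MvPolynomial X (ZMod p)) (FractionRing (MvPolynomial X (ZMod p)))).comp
    (MvPolynomial.map (Int.castRingHom (ZMod p)))

theorem redHom_eq_zero {X : Type*} (p : ℕ) [Fact p.Prime] (f : MvPolynomial X ℤ) :
    redHom X p f = 0 ↔ MvPolynomial.C (p : ℤ) ∣ f := by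
  rw [MvPolynomial.C_dvd_iff_zmod]
  simp only [redHom, RingHom.comp_apply]
  exact map_eq_zero_iff _ (IsFractionRing.injective _ _)

theorem prim_ne {X : Type*} {q : MvPolynomial X ℤ} (h : MvPrimitive q) (p : ℕ)
    [hp : Fact p.Prime] : redHom X p q ≠ 0 := by
  rw [Ne, redHom_eq_zero]
  exact h p (by exact_mod_cast hp.out.one_lt)

theorem prim_of {X : Type*} {q : MvPolynomial X ℤ}
    (h : ∀ (p : ℕ) [Fact p.Prime], redHom X p q ≠ 0) : MvPrimitive q := by
  intro m hm hd
  obtain ⟨p, hp, hpm⟩ := Int.exists_prime_and_dvd (n := m) (by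
    intro h; rw [Int.natAbs_eq_iff] at h; omega)
  have : Fact (p.natAbs).Prime := ⟨Int.prime_iff_natAbs_prime.1 hp⟩
  refine h p.natAbs ((redHom_eq_zero _ _).2 (dvd_trans ?_ hd))
  exact map_dvd MvPolynomial.C ((Int.natAbs_dvd).2 hpm)

theorem ne_zero_of_red {X : Type*} {q : MvPolynomial X ℤ} (p : ℕ) [Fact p.Prime]
    (h : redHom X p q ≠ 0) : algebraMap (MvPolynomial X ℤ) (FracField X) q ≠ 0 := by
  rw [Ne, map_eq_zero_iff _ (IsFractionRing.injective _ _)]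
  rintro rfl
  simp at h

theorem prim_ne' {X : Type*} {q : MvPolynomial X ℤ} (h : MvPrimitive q) :
    algebraMap (MvPolynomial X ℤ) (FracField X) q ≠ 0 := by
  have : Fact (Nat.Prime 2) := ⟨Nat.prime_two⟩
  exact ne_zero_of_red 2 (prim_ne h 2)

theorem prim_mul {X : Type*} {q r : MvPolynomial X ℤ} (h : MvPrimitive q)
    (h' : MvPrimitive r) : MvPrimitive (q * r) := by
  apply prim_of
  intro p _
  rw [map_mul]
  exact mul_ne_zero (prim_ne h p) (prim_ne h' p)

theorem prim_one {X : Type*} : MvPrimitive (1 : MvPolynomial X ℤ) :=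
  prim_of fun p _ => by simp

theorem mem_Radd {X : Type*} {Z : Set X} {a : FracField X} :
    a ∈ Radd X Z ↔ a ∈ Rset X Z := by
  refine ⟨fun h => ?_, fun h => AddSubgroup.subset_closure h⟩
  induction h using AddSubgroup.closure_induction with
  | mem x hx => exact hx
  | zero => exact ⟨0, 1, zero_mem _, one_mem _, prim_one, by simp⟩
  | add x y _ _ hx hy =>
    obtain ⟨f, g, hf, hg, hgp, rfl⟩ := hx
    obtain ⟨f', g', hf', hg', hgp', rfl⟩ := hy
    refine ⟨f * g' + g * f', g * g', add_mem (mul_mem hf hg') (mul_mem hg hf'),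
      mul_mem hg hg', prim_mul hgp hgp', ?_⟩
    rw [div_add_div _ _ (prim_ne' hgp) (prim_ne' hgp')]
    simp
  | neg x _ hx =>
    obtain ⟨f, g, hf, hg, hgp, rfl⟩ := hx
    exact ⟨-f, g, neg_mem hf, hg, hgp, by rw [map_neg, neg_div]⟩

theorem Radd_mono {X : Type*} {Z Z' : Set X} (h : Z ⊆ Z') : Radd X Z ≤ Radd X Z' := by
  intro a ha
  rw [mem_Radd] at ha ⊢
  obtain ⟨f, g, hf, hg, hgp, rfl⟩ := ha
  exact ⟨f, g, MvPolynomial.supported_mono h hf, MvPolynomial.supported_mono h hg, hgp, rfl⟩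

/-- `r ∈ ℚ(X)` is `p`-integral with reduction `l`. -/
def Red {X : Type*} (p : ℕ) [Fact p.Prime] (r : FracField X)
    (l : FractionRing (MvPolynomial X (ZMod p))) : Prop :=
  ∃ f g : MvPolynomial X ℤ, redHom X p g ≠ 0 ∧
    r = algebraMap (MvPolynomial X ℤ) (FracField X) f /
      algebraMap (MvPolynomial X ℤ) (FracField X) g ∧
    l = redHom X p f / redHom X p g

section
variable {X : Type*} {p : ℕ} [hp : Fact p.Prime]

theorem Red.zero : Red (X := X) p 0 0 := ⟨0, 1, by simp, by simp, by simp⟩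

theorem Red.add {r r' : FracField X} {l l'} (h : Red p r l) (h' : Red p r' l') :
    Red p (r + r') (l + l') := by
  obtain ⟨f, g, hg, rfl, rfl⟩ := h
  obtain ⟨f', g', hg', rfl, rfl⟩ := h'
  refine ⟨f * g' + g * f', g * g', ?_, ?_, ?_⟩
  · rw [map_mul]; exact mul_ne_zero hg hg'
  · rw [div_add_div _ _ (ne_zero_of_red p hg) (ne_zero_of_red p hg')]; simp
  · rw [div_add_div _ _ hg hg']; simp

theorem Red.neg {r : FracField X} {l} (h : Red p r l) : Red p (-r) (-l) := by
  obtain ⟨f, g, hg, rfl, rfl⟩ := h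
  exact ⟨-f, g, hg, by rw [map_neg, neg_div], by rw [map_neg, neg_div]⟩

theorem Red.sub {r r' : FracField X} {l l'} (h : Red p r l) (h' : Red p r' l') :
    Red p (r - r') (l - l') := by
  rw [sub_eq_add_neg, sub_eq_add_neg]; exact h.add h'.neg

theorem Red.sum {ι : Type*} (s : Finset ι) {r : ι → FracField X} {l : ι → _}
    (h : ∀ i, Red p (r i) (l i)) : Red p (∑ i ∈ s, r i) (∑ i ∈ s, l i) := by
  classical
  induction s using Finset.induction_on with
  | empty => simpa using Red.zero
  | insert a s ha ih => rw [Finset.sum_insert ha, Finset.sum_insert ha]; exact (h a).add ih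

theorem Red.unique {r : FracField X} {l l'} (h : Red p r l) (h' : Red p r l') : l = l' := by
  obtain ⟨f, g, hg, rfl, rfl⟩ := h
  obtain ⟨f', g', hg', h, rfl⟩ := h'
  rw [div_eq_div_iff (ne_zero_of_red p hg) (ne_zero_of_red p hg'), ← map_mul, ← map_mul] at h
  have := IsFractionRing.injective (MvPolynomial X ℤ) (FracField X) h
  rw [div_eq_div_iff hg hg', ← map_mul, ← map_mul, this]

theorem Red.smul {r : FracField X} {l} (h : Red p r l) : Red p ((p : FracField X) * r) 0 := by
  obtain ⟨f, g, hg, rfl, rfl⟩ := h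
  refine ⟨MvPolynomial.C (p : ℤ) * f, g, hg, ?_, ?_⟩
  · simp [mul_div_assoc]
  · rw [(redHom_eq_zero p _).2 (dvd_mul_right _ _), zero_div]

theorem p_ne : (p : FracField X) ≠ 0 := by
  have h : algebraMap (MvPolynomial X ℤ) (FracField X) (p : MvPolynomial X ℤ) ≠ 0 := by
    rw [Ne, map_eq_zero_iff _ (IsFractionRing.injective _ _)]
    exact_mod_cast hp.out.ne_zero
  simpa using h

theorem Red.exists_div {r : FracField X} (h : Red p r 0) :
    ∃ r' l, Red p r' l ∧ r = (p : FracField X) * r' := by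
  obtain ⟨f, g, hg, rfl, h⟩ := h
  have hf : redHom X p f = 0 := by
    rcases div_eq_zero_iff.1 h.symm with h | h
    · exact h
    · exact absurd h hg
  obtain ⟨f', rfl⟩ := (redHom_eq_zero p _).1 hf
  exact ⟨_, _, ⟨f', g, hg, rfl, rfl⟩, by simp [mul_div_assoc]⟩

theorem supp_of_mul {Z : Set X} {c : ℤ} (hc : c ≠ 0) {f : MvPolynomial X ℤ}
    (h : MvPolynomial.C c * f ∈ MvPolynomial.supported ℤ Z) :
    f ∈ MvPolynomial.supported ℤ Z := by
  rw [MvPolynomial.mem_supported] at h ⊢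
  rwa [MvPolynomial.vars_C_mul _ hc] at h

theorem mem_Radd_of_mul {Z : Set X} {a : FracField X} {l} (ha : Red p a l)
    (h : (p : FracField X) * a ∈ Radd X Z) : a ∈ Radd X Z := by
  rw [mem_Radd] at h ⊢
  obtain ⟨c, q, hc, hq, hqp, h⟩ := h
  have h1 : Red p ((p : FracField X) * a) (redHom X p c / redHom X p q) :=
    ⟨c, q, prim_ne hqp p, h, rfl⟩
  have h2 := h1.unique ha.smul
  have hf : redHom X p c = 0 := by
    rcases div_eq_zero_iff.1 h2 with h | h
    · exact h
    · exact absurd h (prim_ne hqp p)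
  obtain ⟨f', rfl⟩ := (redHom_eq_zero p _).1 hf
  refine ⟨f', q, supp_of_mul (by exact_mod_cast hp.out.ne_zero) hc, hq, hqp, ?_⟩
  apply mul_left_cancel₀ (p_ne (X := X) (p := p))
  rw [h]
  simp [mul_div_assoc]

/-- The subfield `𝔽_p(Z)` of `𝔽_p(X)`. -/
noncomputable def KZ (p : ℕ) [Fact p.Prime] (Z : Set X) :
    Subfield (FractionRing (MvPolynomial X (ZMod p))) where
  carrier := {l | ∃ f g, f ∈ MvPolynomial.supported ℤ Z ∧ g ∈ MvPolynomial.supported ℤ Z ∧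
    redHom X p g ≠ 0 ∧ l = redHom X p f / redHom X p g}
  zero_mem' := ⟨0, 1, zero_mem _, one_mem _, by simp, by simp⟩
  one_mem' := ⟨1, 1, one_mem _, one_mem _, by simp, by simp⟩
  add_mem' := by
    rintro _ _ ⟨f, g, hf, hg, h, rfl⟩ ⟨f', g', hf', hg', h', rfl⟩
    refine ⟨f * g' + g * f', g * g', add_mem (mul_mem hf hg') (mul_mem hg hf'), mul_mem hg hg',
      ?_, ?_⟩
    · rw [map_mul]; exact mul_ne_zero h h'
    · rw [div_add_div _ _ h h']; simp
  mul_mem' := by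
    rintro _ _ ⟨f, g, hf, hg, h, rfl⟩ ⟨f', g', hf', hg', h', rfl⟩
    refine ⟨f * f', g * g', mul_mem hf hf', mul_mem hg hg', ?_, ?_⟩
    · rw [map_mul]; exact mul_ne_zero h h'
    · rw [div_mul_div_comm, map_mul, map_mul]
  neg_mem' := by
    rintro _ ⟨f, g, hf, hg, h, rfl⟩
    exact ⟨-f, g, neg_mem hf, hg, h, by rw [map_neg, neg_div]⟩
  inv_mem' := by
    rintro _ ⟨f, g, hf, hg, h, rfl⟩
    by_cases h0 : redHom X p f = 0
    · exact ⟨0, 1, zero_mem _, one_mem _, by simp, by simp [h0]⟩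
    · exact ⟨g, f, hg, hf, h0, by rw [inv_div]⟩

theorem exists_prim (g : MvPolynomial X ℤ) (hg : g ≠ 0) :
    ∃ c : ℤ, ∃ g', c ≠ 0 ∧ MvPrimitive g' ∧ g = MvPolynomial.C c * g' := by
  obtain ⟨s, hs⟩ := MvPolynomial.ne_zero_iff.1 hg
  induction hN : (MvPolynomial.coeff s g).natAbs using Nat.strong_induction_on generalizing g with
  | _ N ih =>
    by_cases h : MvPrimitive g
    · exact ⟨1, g, one_ne_zero, h, by simp⟩
    · unfold MvPrimitive at h
      push Not at h
      obtain ⟨m, hm, g1, rfl⟩ := h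
      have hs' : MvPolynomial.coeff s g1 ≠ 0 := by
        intro h0
        exact hs (by rw [MvPolynomial.coeff_C_mul, h0, mul_zero])
      have hg1 : g1 ≠ 0 := by rintro rfl; simp at hs'
      obtain ⟨c, g', hc, hgp, h⟩ := ih (MvPolynomial.coeff s g1).natAbs (by
        rw [← hN, MvPolynomial.coeff_C_mul, Int.natAbs_mul]
        have h1 : 0 < (MvPolynomial.coeff s g1).natAbs := Int.natAbs_pos.2 hs'
        have h2 : 1 < m.natAbs := by omega
        nlinarith) g1 hg1 hs' rfl
      refine ⟨m * c, g', mul_ne_zero (by omega) hc, hgp, ?_⟩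
      rw [h, map_mul, mul_assoc]

theorem exists_lift {Z : Set X} {l} (h : l ∈ KZ (X := X) p Z) : ∃ r ∈ Radd X Z, Red p r l := by
  obtain ⟨f, g, hf, hg, h, rfl⟩ := h
  obtain ⟨c, g', hc, hgp, rfl⟩ := exists_prim g (by rintro rfl; simp at h)
  have hcp : ((c : ℤ) : ZMod p) ≠ 0 := by
    intro h0
    apply h
    rw [redHom_eq_zero]
    exact (map_dvd MvPolynomial.C ((ZMod.intCast_zmod_eq_zero_iff_dvd _ _).1 h0)).mul_right _
  obtain ⟨d, hd⟩ := ZMod.intCast_surjective ((c : ZMod p)⁻¹)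
  have hcd : redHom X p (MvPolynomial.C c) * redHom X p (MvPolynomial.C d) = 1 := by
    rw [← map_mul, ← map_mul]
    simp only [redHom, RingHom.comp_apply, MvPolynomial.map_C]
    rw [map_mul]
    simp only [eq_intCast, hd]
    rw [mul_inv_cancel₀ hcp]
    simp
  have hpr := prim_ne hgp p
  refine ⟨_, mem_Radd.2 ⟨MvPolynomial.C d * f, g', mul_mem (Subalgebra.algebraMap_mem _ d) hf,
    supp_of_mul hc hg, hgp, rfl⟩, _, _, hpr, rfl, ?_⟩
  rw [map_mul] at h
  have h1 := left_ne_zero_of_mul h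
  rw [map_mul, map_mul, div_eq_div_iff (mul_ne_zero h1 hpr) hpr]
  linear_combination (-redHom X p f * redHom X p g') * hcd

theorem exists_red {Z : Set X} {r} (h : r ∈ Radd X Z) : ∃ l ∈ KZ (X := X) p Z, Red p r l := by
  obtain ⟨f, g, hf, hg, hgp, rfl⟩ := mem_Radd.1 h
  exact ⟨_, ⟨f, g, hf, hg, prim_ne hgp p, rfl⟩, f, g, prim_ne hgp p, rfl, rfl⟩

end

section
variable {X : Type*} (p : ℕ) [hp : Fact p.Prime] (v : X)

open Classical in
/-- Substitute a formal variable for `v`. -/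
noncomputable def subst1 : MvPolynomial X (ZMod p) →+* Polynomial (MvPolynomial X (ZMod p)) :=
  MvPolynomial.eval₂Hom (Polynomial.C.comp MvPolynomial.C)
    (fun i => if i = v then Polynomial.X else Polynomial.C (MvPolynomial.X i))

theorem subst1_injective : Function.Injective (subst1 p v) := by
  have h : (Polynomial.eval₂RingHom (RingHom.id _) (MvPolynomial.X v)).comp (subst1 p v) =
      RingHom.id _ := by
    apply MvPolynomial.ringHom_ext
    · intro r; simp [subst1]
    · intro i
      by_cases hi : i = v
      · subst hi; simp [subst1]
      · simp [subst1, hi]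
  intro a b hab
  have := congrArg (Polynomial.eval₂RingHom (RingHom.id _) (MvPolynomial.X v)) hab
  rw [← RingHom.comp_apply, ← RingHom.comp_apply, h] at this
  exact this

noncomputable def subst2 : MvPolynomial X (ZMod p) →+*
    LaurentSeries (FractionRing (MvPolynomial X (ZMod p))) :=
  (HahnSeries.ofPowerSeries ℤ _).comp (Polynomial.coeToPowerSeries.ringHom.comp
    ((Polynomial.mapRingHom (algebraMap _ _)).comp (subst1 p v)))

theorem subst2_injective : Function.Injective (subst2 p v) := by
  unfold subst2
  simp only [RingHom.coe_comp]
  refine HahnSeries.ofPowerSeries_injective.comp (Function.Injective.comp ?_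
    (Function.Injective.comp ?_ (subst1_injective p v)))
  · exact Polynomial.coe_injective _
  · exact Polynomial.map_injective _ (IsFractionRing.injective _ _)

/-- The expansion `𝔽_p(X) → 𝔽_p(X)((t))` in powers of the variable `v`. -/
noncomputable def expand : FractionRing (MvPolynomial X (ZMod p)) →+*
    LaurentSeries (FractionRing (MvPolynomial X (ZMod p))) :=
  IsFractionRing.lift (subst2_injective p v)

theorem expand_alg (f) : expand p v (algebraMap (MvPolynomial X (ZMod p)) _ f) = subst2 p v f :=
  IsFractionRing.lift_algebraMap _ _

theorem expand_X_self : expand p v (redHom X p (MvPolynomial.X v)) = HahnSeries.single 1 1 := by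
  simp [redHom, expand_alg, subst2, subst1]

theorem expand_X_ne {i : X} (h : i ≠ v) : expand p v (redHom X p (MvPolynomial.X i)) =
    HahnSeries.C (redHom X p (MvPolynomial.X i)) := by
  simp [redHom, expand_alg, subst2, subst1, h]

theorem expand_const {Z : Set X} (hv : v ∉ Z) {l} (hl : l ∈ KZ p Z) :
    expand p v l = HahnSeries.C l := by
  have key : ∀ f ∈ MvPolynomial.supported ℤ Z,
      expand p v (redHom X p f) = HahnSeries.C (redHom X p f) := by
    intro f hf
    refine MvPolynomial.hom_congr_vars (f₁ := (expand p v).comp (redHom X p))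
      (f₂ := HahnSeries.C.comp (redHom X p)) (RingHom.ext_int _ _) ?_ rfl
    intro i hi _
    refine expand_X_ne p v ?_
    rintro rfl
    exact hv (MvPolynomial.mem_supported.1 hf hi)
  obtain ⟨f, g, hf, hg, h, rfl⟩ := hl
  rw [map_div₀, map_div₀, key f hf, key g hg]

/-- Coefficientwise map of Laurent series. -/
noncomputable def lmap {K L : Type*} [Field K] [Field L] (φ : K →+* L) :
    LaurentSeries K →+* LaurentSeries L where
  toFun s := HahnSeries.map s φ
  map_zero' := by ext; simp
  map_one' := by
    ext n
    by_cases h : n = 0 <;> simp [HahnSeries.coeff_one, h]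
  map_add' a b := by ext; simp
  map_mul' a b := HahnSeries.map_mul (φ : K →ₙ+* L)

theorem lmap_coeff {K L : Type*} [Field K] [Field L] (φ : K →+* L) (s : LaurentSeries K) (n : ℤ) :
    (lmap φ s).coeff n = φ (s.coeff n) := rfl

theorem expand_coeff {Z : Set X} {l} (hl : l ∈ KZ p (insert v Z)) (n : ℤ) :
    (expand p v l).coeff n ∈ KZ p Z := by
  set T := (lmap (KZ p Z).subtype).fieldRange with hT
  have key : ∀ f ∈ MvPolynomial.supported ℤ (insert v Z), expand p v (redHom X p f) ∈ T := by
    intro f hf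
    rw [MvPolynomial.supported_eq_adjoin_X] at hf
    induction hf using Algebra.adjoin_induction with
    | mem x hx =>
      obtain ⟨i, hi, rfl⟩ := hx
      by_cases hiv : i = v
      · subst hiv
        rw [expand_X_self]
        refine ⟨HahnSeries.single 1 1, ?_⟩
        ext n
        by_cases h : n = 1 <;> simp [lmap_coeff, HahnSeries.coeff_single, h]
      · rw [expand_X_ne p v hiv]
        have hm : redHom X p (MvPolynomial.X i) ∈ KZ p Z :=
          ⟨MvPolynomial.X i, 1, MvPolynomial.X_mem_supported.2 (hi.resolve_left hiv), one_mem _,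
            by simp, by simp⟩
        refine ⟨HahnSeries.C ⟨_, hm⟩, ?_⟩
        ext n
        by_cases h : n = 0 <;> simp [lmap_coeff, HahnSeries.C_apply, HahnSeries.coeff_single, h]
    | algebraMap r =>
      have : expand p v (redHom X p (algebraMap ℤ _ r)) = (r : LaurentSeries _) := by
        simp
      rw [this]
      exact intCast_mem T r
    | add x y _ _ hx hy => rw [map_add, map_add]; exact add_mem hx hy
    | mul x y _ _ hx hy => rw [map_mul, map_mul]; exact mul_mem hx hy
  obtain ⟨f, g, hf, hg, h, rfl⟩ := hl
  have : expand p v (redHom X p f / redHom X p g) ∈ T := by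
    rw [map_div₀]; exact div_mem (key f hf) (key g hg)
  obtain ⟨s, hs⟩ := this
  rw [← hs]
  exact (s.coeff n).2

end

theorem main_step {X : Type*} (p : ℕ) [hp : Fact p.Prime] (n : ℕ) : ∀ (Y : Set X) (x : Fin n → X)
    (_ : Function.Injective x) (_ : ∀ i, x i ∉ Y) (a : FracField X) (l) (_ : Red p a l)
    (b : Fin n → FracField X) (_ : ∀ i, b i ∈ Radd X ((Set.range x \ {x i}) ∪ Y))
    (_ : (p : FracField X) * a = ∑ i, b i),
    a ∈ (⨆ i : Fin n, Radd X ((Set.range x \ {x i}) ∪ Y)) := by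
  induction n with
  | zero =>
    intro Y x _ _ a l _ b _ h
    simp only [Finset.univ_eq_empty, Finset.sum_empty, mul_eq_zero] at h
    rw [h.resolve_left p_ne]
    exact zero_mem _
  | succ n ih =>
    intro Y x hinj hxY a l ha b hb hsum
    set v := x (Fin.last n) with hv
    set x' : Fin n → X := fun j => x j.castSucc with hx'
    have hinj' : Function.Injective x' := fun i j h => Fin.castSucc_injective n (hinj h)
    have hne : ∀ j, x' j ≠ v := fun j h => (Fin.castSucc_lt_last j).ne (hinj h)
    have hrange : Set.range x = insert v (Set.range x') := by
      ext z
      simp only [Set.mem_range, Set.mem_insert_iff, Fin.exists_fin_succ']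
      rw [or_comm, eq_comm (a := z)]
    have hset : ∀ j : Fin n, (Set.range x \ {x j.castSucc}) ∪ Y =
        (Set.range x' \ {x' j}) ∪ insert v Y := by
      intro j
      have := hne j
      ext z
      simp only [hrange, Set.mem_union, Set.mem_sdiff, Set.mem_insert_iff, Set.mem_singleton_iff]
      change _ ∧ ¬ z = x' j ∨ _ ↔ _
      by_cases hz : z = v
      · subst hz; simp [this.symm]
      · simp [hz]
    have hset' : ∀ j : Fin n, (Set.range x' \ {x' j}) ∪ insert v Y =
        insert v ((Set.range x' \ {x' j}) ∪ Y) := fun j => Set.union_insert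
    have hvr : v ∉ Set.range x' := by rintro ⟨j, hj⟩; exact hne j hj
    have hvY : v ∉ Y := hxY _
    have hlast : (Set.range x \ {x (Fin.last n)}) ∪ Y = Set.range x' ∪ Y := by
      rw [hrange, ← hv, Set.insert_sdiff_self_of_notMem hvr]
    have hvl : v ∉ Set.range x' ∪ Y := by simp only [Set.mem_union, not_or]; exact ⟨hvr, hvY⟩
    choose L hLK hL using fun i => exists_red (p := p) (hb i)
    have hL0 : ∑ i, L i = 0 := by
      have h1 := Red.sum Finset.univ hL
      rw [← hsum] at h1
      exact h1.unique ha.smul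
    have hc : ∀ j : Fin n, ∃ r ∈ Radd X ((Set.range x' \ {x' j}) ∪ Y),
        Red p r ((expand p v (L j.castSucc)).coeff 0) := by
      intro j
      apply exists_lift
      apply expand_coeff
      have := hLK j.castSucc
      rwa [hset, hset'] at this
    choose c hcR hc using hc
    have hlastL : (expand p v (L (Fin.last n))).coeff 0 = L (Fin.last n) := by
      have := hLK (Fin.last n)
      rw [hlast] at this
      rw [expand_const p v hvl this]
      simp [HahnSeries.C_apply]
    have hsumc : ∑ j : Fin n, (expand p v (L j.castSucc)).coeff 0 + L (Fin.last n) = 0 := by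
      have h1 := congrArg (fun s => (expand p v s).coeff 0) hL0
      simp only [map_sum, map_zero, HahnSeries.coeff_zero] at h1
      rw [HahnSeries.coeff_sum, Fin.sum_univ_castSucc, hlastL] at h1
      exact h1
    rw [Fin.sum_univ_castSucc] at hL0 hsum
    have hd : Red p (∑ j : Fin n, (b j.castSucc - c j)) 0 := by
      have h1 := Red.sum Finset.univ (fun j : Fin n => (hL j.castSucc).sub (hc j))
      rw [Finset.sum_sub_distrib (fun j : Fin n => L j.castSucc)] at h1
      rwa [eq_neg_of_add_eq_zero_left hL0, eq_neg_of_add_eq_zero_left hsumc, sub_self] at h1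
    obtain ⟨a', l', ha', hpa'⟩ := hd.exists_div
    have hI := ih (insert v Y) x' hinj' (fun j => by
      rw [Set.mem_insert_iff, not_or]; exact ⟨hne j, hxY _⟩) a' l' ha'
      (fun j => b j.castSucc - c j) (fun j => by
        have h1 := hb j.castSucc
        rw [hset] at h1
        refine sub_mem h1 (Radd_mono ?_ (hcR j))
        rw [hset']; exact Set.subset_insert _ _) hpa'.symm
    have h1 : a' ∈ ⨆ i : Fin (n + 1), Radd X ((Set.range x \ {x i}) ∪ Y) := by
      refine (iSup_le fun j => ?_ : (⨆ j : Fin n, Radd X ((Set.range x' \ {x' j}) ∪ insert v Y)) ≤ _) hI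
      rw [← hset]
      exact le_iSup (fun i : Fin (n + 1) => Radd X ((Set.range x \ {x i}) ∪ Y)) j.castSucc
    have h2 : a - a' ∈ Radd X ((Set.range x \ {x (Fin.last n)}) ∪ Y) := by
      apply mem_Radd_of_mul (ha.sub ha')
      have : (p : FracField X) * (a - a') = ∑ j, c j + b (Fin.last n) := by
        rw [mul_sub, hsum, ← hpa', Finset.sum_sub_distrib]; ring
      rw [this]
      refine add_mem (sum_mem fun j _ => Radd_mono ?_ (hcR j)) (hb _)
      rw [hlast]
      exact Set.union_subset_union_left _ Set.sdiff_subset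
    have h3 := add_mem (AddSubgroup.mem_iSup_of_mem
      (S := fun i : Fin (n + 1) => Radd X ((Set.range x \ {x i}) ∪ Y)) (Fin.last n) h2) h1
    rwa [sub_add_cancel] at h3

theorem mem_iSup_sum {A : Type*} [AddCommGroup A] {n : ℕ} (S : Fin n → AddSubgroup A) {a : A}
    (h : a ∈ ⨆ i, S i) : ∃ b : Fin n → A, (∀ i, b i ∈ S i) ∧ a = ∑ i, b i := by
  induction h using AddSubgroup.iSup_induction' with
  | hp i y hy =>
    refine ⟨Pi.single i y, fun j => ?_, by simp⟩
    by_cases h : j = i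
    · subst h; simpa using hy
    · simp [h, zero_mem]
  | h1 => exact ⟨0, fun i => zero_mem _, by simp⟩
  | hadd y z _ _ hy hz =>
    obtain ⟨b, hb, rfl⟩ := hy
    obtain ⟨c, hc, rfl⟩ := hz
    exact ⟨b + c, fun i => add_mem (hb i) (hc i), by simp [Finset.sum_add_distrib]⟩

theorem nat_version {X : Type*} (Y : Set X) (n : ℕ) (x : Fin n → X)
    (hinj : Function.Injective x) (hxY : ∀ i, x i ∉ Y) (m : ℕ) :
    m ≠ 0 → ∀ a ∈ Radd X (Set.range x ∪ Y),
      m • a ∈ (⨆ i : Fin n, Radd X ((Set.range x \ {x i}) ∪ Y)) →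
      a ∈ (⨆ i : Fin n, Radd X ((Set.range x \ {x i}) ∪ Y)) := by
  induction m using induction_on_primes with
  | zero => intro h; exact absurd rfl h
  | one => intro _ a _ h; simpa using h
  | prime_mul p k hp ih =>
    intro hm a ha h
    have : Fact p.Prime := ⟨hp⟩
    refine ih (right_ne_zero_of_mul hm) a ha ?_
    rw [mul_smul] at h
    obtain ⟨b, hb, hsum⟩ := mem_iSup_sum _ h
    obtain ⟨l, _, hl⟩ := exists_red (p := p) (nsmul_mem ha k)
    rw [nsmul_eq_mul] at hsum
    exact main_step p n Y x hinj hxY _ l hl b hb hsum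

/-- With `G = R⁺_{W ∪ Y}` and `I = Σ_i R⁺_{W(i) ∪ Y}` as before,
the quotient `G / I` is torsion-free: for every nonzero integer `m` and every
`a ∈ G`, if `m • a ∈ I` then `a ∈ I`. -/
theorem quotient_torsionFree {X : Type*} (Y : Set X) (n : ℕ) (x : Fin n → X)
    (hinj : Function.Injective x) (hxY : ∀ i, x i ∉ Y) :
    ∀ m : ℤ, m ≠ 0 → ∀ a ∈ Radd X (Set.range x ∪ Y),
      m • a ∈ (⨆ i : Fin n, Radd X ((Set.range x \ {x i}) ∪ Y)) →
      a ∈ (⨆ i : Fin n, Radd X ((Set.range x \ {x i}) ∪ Y)) := by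
  intro m hm a ha h
  refine nat_version Y n x hinj hxY m.natAbs (Int.natAbs_ne_zero.2 hm) a ha ?_
  rcases Int.natAbs_eq m with h' | h'
  · rw [h', natCast_zsmul] at h
    exact h
  · rw [h', neg_smul, natCast_zsmul] at h
    simpa using h
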